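/- For every integer w ≥ 2 and every Sylow 2-subgroup D̃ of the double cover S̃_{2w}, the central element z lies in the commutator subgroup of D̃; equivalently, every group homomorphism from D̃ to the multiplicative group ℂˣ sends z to 1 (there are no linear spin characters of D̃). -/

import Mathlib

/-- Relations defining the double cover `S̃ₙ` of the symmetric group:
generators are `none = z` and `some i = tᵢ` for `i : Fin (n-1)`, with relations
`z² = 1`, `tᵢ² = z`, `(tᵢ tᵢ₊₁)³ = z` and `(tᵢ tⱼ)² = z` for `|i - j| ≥ 2`. -/
def spinRels (n : ℕ) : Set (FreeGroup (Option (Fin (n - 1)))) :=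
  {r | r = FreeGroup.of (none : Option (Fin (n - 1))) ^ 2}
  ∪ {r | ∃ i : Fin (n - 1), r = FreeGroup.of (some i) ^ 2 * (FreeGroup.of none)⁻¹}
  ∪ {r | ∃ i j : Fin (n - 1), (j : ℕ) = (i : ℕ) + 1 ∧
      r = (FreeGroup.of (some i) * FreeGroup.of (some j)) ^ 3 * (FreeGroup.of none)⁻¹}
  ∪ {r | ∃ i j : Fin (n - 1), ((i : ℕ) + 2 ≤ (j : ℕ) ∨ (j : ℕ) + 2 ≤ (i : ℕ)) ∧
      r = (FreeGroup.of (some i) * FreeGroup.of (some j)) ^ 2 * (FreeGroup.of none)⁻¹}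

/-- The double cover `S̃ₙ` of the symmetric group, as a presented group. -/
abbrev SpinSym (n : ℕ) : Type := PresentedGroup (spinRels n)

/-- The central element `z` of `S̃ₙ`. -/
def spinZ (n : ℕ) : SpinSym n := PresentedGroup.of none

/-- The generator `tᵢ` of `S̃ₙ`. -/
def spinT (n : ℕ) (i : Fin (n - 1)) : SpinSym n := PresentedGroup.of (some i)

/-- The `i`-th point of `Fin n`, for `i : Fin (n-1)`. -/
def finL {n : ℕ} (i : Fin (n - 1)) : Fin n := ⟨(i : ℕ), by have := i.2; omega⟩

/-- The `(i+1)`-st point of `Fin n`, for `i : Fin (n-1)`. -/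
def finR {n : ℕ} (i : Fin (n - 1)) : Fin n := ⟨(i : ℕ) + 1, by have := i.2; omega⟩

/-- `π : S̃ₙ → Sₙ` is the canonical projection iff `π z = 1` and `π tᵢ` is the
transposition of the `i`-th and `(i+1)`-st points. -/
def IsSpinProj (n : ℕ) (π : SpinSym n →* Equiv.Perm (Fin n)) : Prop :=
  π (spinZ n) = 1 ∧ ∀ i : Fin (n - 1), π (spinT n i) = Equiv.swap (finL i) (finR i)

/-- The double cover `Ãₙ = π⁻¹(Aₙ)` of the alternating group, as a subgroup of `S̃ₙ`. -/
def SpinAlt (n : ℕ) (π : SpinSym n →* Equiv.Perm (Fin n)) : Subgroup (SpinSym n) :=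
  (alternatingGroup (Fin n)).comap π

/-- The central element `z`, as an element of `Ãₙ`. -/
def spinZA (n : ℕ) (π : SpinSym n →* Equiv.Perm (Fin n)) (hπ : IsSpinProj n π) :
    ↥(SpinAlt n π) :=
  ⟨spinZ n, Subgroup.mem_comap.mpr (by rw [hπ.1]; exact Subgroup.one_mem _)⟩

/-- The descending word `s n * s (n - 1) * ⋯` with `m` letters. -/
def descendingWord {G : Type*} [Group G] (s : ℕ → G) (n : ℕ) : ℕ → G
  | 0 => 1
  | m + 1 => descendingWord s n m * s (n - m)

section BraidRelations

variable {G : Type*} [Group G] {s : ℕ → G} {n : ℕ}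

theorem commute_descendingWord
    (hcomm : ∀ i j, i + 2 ≤ j → j ≤ n → Commute (s i) (s j)) {i m : ℕ} (him : i + m < n) :
    Commute (descendingWord s n m) (s i) := by
  induction m with
  | zero => exact Commute.one_left _
  | succ m ih =>
    exact (ih (by omega)).mul_left (hcomm i (n - m) (by omega) (by omega)).symm

theorem descendingWord_mul_of_lt
    (hbraid : ∀ i, i + 1 ≤ n → s i * s (i + 1) * s i = s (i + 1) * s i * s (i + 1))
    (hcomm : ∀ i j, i + 2 ≤ j → j ≤ n → Commute (s i) (s j)) {i m : ℕ} (hi : i + 1 ≤ n)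
    (hm : m ≤ n + 1) (him : n + 1 ≤ i + m) :
    descendingWord s n m * s (i + 1) = s i * descendingWord s n m := by
  induction m with
  | zero => omega
  | succ m ih =>
    rcases Nat.lt_or_ge n (i + m) with h | h
    · have hc : Commute (s (n - m)) (s (i + 1)) := hcomm _ _ (by omega) hi
      rw [descendingWord, mul_assoc, hc.eq, ← mul_assoc, ih (by omega) (by omega), mul_assoc]
    · obtain ⟨k, rfl⟩ : ∃ k, m = k + 1 := ⟨m - 1, by omega⟩
      have hc : Commute (descendingWord s n k) (s i) :=
        commute_descendingWord hcomm (by omega)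
      have h₁ : n - k = i + 1 := by omega
      have h₂ : n - (k + 1) = i := by omega
      rw [descendingWord, descendingWord, h₁, h₂]
      calc descendingWord s n k * s (i + 1) * s i * s (i + 1)
          = descendingWord s n k * (s (i + 1) * s i * s (i + 1)) := by group
        _ = descendingWord s n k * s i * (s (i + 1) * s i) := by rw [← hbraid i hi]; group
        _ = s i * (descendingWord s n k * s (i + 1) * s i) := by rw [hc.eq]; group

/-- A group generated by finitely many involutions satisfying the relations of the adjacent
transpositions is finite. -/
theorem finite_closure_of_braid_relations (s : ℕ → G) (n : ℕ) (hsq : ∀ i < n, s i * s i = 1)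
    (hbraid : ∀ i, i + 1 < n → s i * s (i + 1) * s i = s (i + 1) * s i * s (i + 1))
    (hcomm : ∀ i j, i + 2 ≤ j → j < n → Commute (s i) (s j)) :
    (Subgroup.closure (s '' Set.Iio n) : Set G).Finite := by
  induction n with
  | zero => simp
  | succ n ih =>
    have hfin := ih (fun i hi => hsq i (by omega)) (fun i hi => hbraid i (by omega))
      fun i j hij hj => hcomm i j hij (by omega)
    set H := Subgroup.closure (s '' Set.Iio n)
    have hsH : ∀ i < n, s i ∈ H := fun i hi => Subgroup.subset_closure ⟨i, hi, rfl⟩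
    have hcomm' : ∀ i j, i + 2 ≤ j → j ≤ n → Commute (s i) (s j) :=
      fun i j hij hj => hcomm i j hij (by omega)
    have hstep : ∀ h ∈ H, ∀ m ≤ n + 1, ∀ i ≤ n,
        ∃ h' ∈ H, ∃ m' ≤ n + 1, h * descendingWord s n m * s i = h' * descendingWord s n m' := by
      intro h hh m hm i hi
      rcases lt_trichotomy (i + m) n with him | him | him
      · refine ⟨h * s i, H.mul_mem hh (hsH i (by omega)), m, hm, ?_⟩
        rw [mul_assoc, (commute_descendingWord hcomm' him).eq, mul_assoc]
      · refine ⟨h, hh, m + 1, by omega, ?_⟩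
        rw [descendingWord, show n - m = i by omega, mul_assoc]
      · obtain him | him : i + m = n + 1 ∨ n + 1 < i + m := by omega
        · obtain ⟨k, rfl⟩ : ∃ k, m = k + 1 := ⟨m - 1, by omega⟩
          refine ⟨h, hh, k, by omega, ?_⟩
          rw [descendingWord, show n - k = i by omega, mul_assoc, mul_assoc,
            hsq i (by omega), mul_one]
        · obtain ⟨j, rfl⟩ : ∃ j, i = j + 1 := ⟨i - 1, by omega⟩
          refine ⟨h * s j, H.mul_mem hh (hsH j (by omega)), m, hm, ?_⟩
          rw [mul_assoc, descendingWord_mul_of_lt (fun i hi => hbraid i (by omega)) hcomm' hi hm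
            (by omega), mul_assoc]
    refine (Set.Finite.image2 (fun h m => h * descendingWord s n m) hfin
      (Set.finite_Iic (n + 1))).subset fun x hx => ?_
    induction hx using Subgroup.closure_induction_right with
    | one => exact ⟨1, H.one_mem, 0, Nat.zero_le _, by simp [descendingWord]⟩
    | mul_right x hx y hy ih =>
      obtain ⟨i, hi, rfl⟩ := hy
      obtain ⟨h, hh, m, hm, rfl⟩ := ih
      obtain ⟨h', hh', m', hm', he⟩ := hstep h hh m hm i (Nat.lt_succ_iff.mp hi)
      exact ⟨h', hh', m', hm', he.symm⟩
    | mul_inv_cancel x hx y hy ih =>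
      obtain ⟨i, hi, rfl⟩ := hy
      obtain ⟨h, hh, m, hm, rfl⟩ := ih
      obtain ⟨h', hh', m', hm', he⟩ := hstep h hh m hm i (Nat.lt_succ_iff.mp hi)
      exact ⟨h', hh', m', hm', by
        rw [inv_eq_of_mul_eq_one_left (hsq i hi)]; exact he.symm⟩

end BraidRelations

section SpinRelations

variable {n : ℕ}

theorem spinZ_sq : spinZ n ^ 2 = 1 :=
  PresentedGroup.one_of_mem (rels := spinRels n) (Or.inl (Or.inl (Or.inl rfl)))

theorem spinT_sq (i : Fin (n - 1)) : spinT n i ^ 2 = spinZ n :=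
  mul_inv_eq_one.mp
    (PresentedGroup.one_of_mem (rels := spinRels n) (Or.inl (Or.inl (Or.inr ⟨i, rfl⟩))))

theorem spinT_mul_spinT_pow_three {i j : Fin (n - 1)} (h : (j : ℕ) = i + 1) :
    (spinT n i * spinT n j) ^ 3 = spinZ n :=
  mul_inv_eq_one.mp
    (PresentedGroup.one_of_mem (rels := spinRels n) (Or.inl (Or.inr ⟨i, j, h, rfl⟩)))

theorem spinT_mul_spinT_sq {i j : Fin (n - 1)} (h : (i : ℕ) + 2 ≤ j) :
    (spinT n i * spinT n j) ^ 2 = spinZ n :=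
  mul_inv_eq_one.mp
    (PresentedGroup.one_of_mem (rels := spinRels n) (Or.inr ⟨i, j, Or.inl h, rfl⟩))

theorem closure_insert_spinZ_range_spinT :
    Subgroup.closure (insert (spinZ n) (Set.range (spinT n))) = ⊤ := by
  rw [← PresentedGroup.closure_range_of (spinRels n)]
  congr 1
  ext x
  constructor
  · rintro (rfl | ⟨i, rfl⟩)
    exacts [⟨none, rfl⟩, ⟨some i, rfl⟩]
  · rintro ⟨_ | i, rfl⟩
    exacts [Or.inl rfl, Or.inr ⟨i, rfl⟩]

theorem commute_spinZ (x : SpinSym n) : Commute x (spinZ n) := by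
  have hx : x ∈ Subgroup.closure (insert (spinZ n) (Set.range (spinT n))) :=
    closure_insert_spinZ_range_spinT ▸ Subgroup.mem_top x
  induction hx using Subgroup.closure_induction with
  | mem x hx =>
    obtain rfl | ⟨i, rfl⟩ := hx
    · exact Commute.refl _
    · exact spinT_sq i ▸ Commute.self_pow _ 2
  | one => exact Commute.one_left _
  | mul x y _ _ hx hy => exact hx.mul_left hy
  | inv x _ hx => exact hx.inv_left

theorem spinT_pow_four (i : Fin (n - 1)) : spinT n i ^ 4 = 1 := by
  rw [show 4 = 2 * 2 from rfl, pow_mul, spinT_sq, spinZ_sq]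

theorem spinT_inv (i : Fin (n - 1)) : (spinT n i)⁻¹ = spinZ n * spinT n i :=
  inv_eq_of_mul_eq_one_left (by rw [mul_assoc, ← sq, spinT_sq, ← sq, spinZ_sq])

open scoped commutatorElement in
theorem commutator_spinT {i j : Fin (n - 1)} (h : (i : ℕ) + 2 ≤ j) :
    ⁅spinT n i, spinT n j⁆ = spinZ n := by
  rw [commutatorElement_def, spinT_inv, spinT_inv]
  calc spinT n i * spinT n j * (spinZ n * spinT n i) * (spinZ n * spinT n j)
      = spinT n i * spinT n j * (spinZ n * (spinT n i * spinZ n)) * spinT n j := by group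
    _ = spinT n i * spinT n j * (spinZ n ^ 2 * spinT n i) * spinT n j := by
        rw [(commute_spinZ _).eq, ← mul_assoc (spinZ n), ← sq]
    _ = (spinT n i * spinT n j) ^ 2 := by rw [spinZ_sq, one_mul]; simp only [sq, mul_assoc]
    _ = spinZ n := spinT_mul_spinT_sq h

end SpinRelations

instance normal_zpowers_spinZ (n : ℕ) : (Subgroup.zpowers (spinZ n)).Normal :=
  ⟨by
    rintro _ ⟨m, rfl⟩ g
    change g * spinZ n ^ m * g⁻¹ ∈ _
    rw [((commute_spinZ g).zpow_right m).eq, mul_inv_cancel_right]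
    exact Subgroup.zpow_mem_zpowers _ m⟩

instance finite_spinSym (n : ℕ) : Finite (SpinSym n) := by
  let K := Subgroup.zpowers (spinZ n)
  have hK : Finite K := (isOfFinOrder_iff_pow_eq_one.mpr ⟨2, two_pos, spinZ_sq⟩).finite_zpowers
  let q : SpinSym n →* SpinSym n ⧸ K := QuotientGroup.mk' K
  have hz : q (spinZ n) = 1 := (QuotientGroup.eq_one_iff _).mpr (Subgroup.mem_zpowers _)
  let s : ℕ → SpinSym n ⧸ K := fun i => if h : i < n - 1 then q (spinT n ⟨i, h⟩) else 1
  have hs : ∀ i (h : i < n - 1), s i = q (spinT n ⟨i, h⟩) := fun i h => dif_pos h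
  have hsq : ∀ i < n - 1, s i * s i = 1 := fun i hi => by
    rw [hs i hi, ← map_mul, ← sq, spinT_sq, hz]
  have hinv : ∀ i < n - 1, (s i)⁻¹ = s i := fun i hi => inv_eq_of_mul_eq_one_left (hsq i hi)
  have hfin := finite_closure_of_braid_relations s (n - 1) hsq
    (fun i hi => by
      have h₃ : (s i * s (i + 1)) ^ 3 = 1 := by
        rw [hs i (by omega), hs (i + 1) hi, ← map_mul, ← map_pow,
          spinT_mul_spinT_pow_three rfl, hz]
      have h : (s i * s (i + 1) * s i) * (s (i + 1) * s i * s (i + 1)) = 1 := by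
        rw [← h₃]; simp only [pow_succ, pow_zero, one_mul, mul_assoc]
      rw [eq_inv_of_mul_eq_one_left h, mul_inv_rev, mul_inv_rev, hinv _ hi,
        hinv i (by omega), mul_assoc])
    (fun i j hij hj => by
      have h₂ : (s i * s j) ^ 2 = 1 := by
        rw [hs i (by omega), hs j hj, ← map_mul, ← map_pow, spinT_mul_spinT_sq hij, hz]
      have h : (s i * s j) * (s i * s j) = 1 := by rw [← sq, h₂]
      rw [Commute, SemiconjBy, eq_inv_of_mul_eq_one_left h, mul_inv_rev, hinv j hj,
        hinv i (by omega)])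
  have htop : Subgroup.closure (s '' Set.Iio (n - 1)) = ⊤ := by
    rw [eq_top_iff, ← Subgroup.map_top_of_surjective q (QuotientGroup.mk'_surjective K),
      ← closure_insert_spinZ_range_spinT, MonoidHom.map_closure, Subgroup.closure_le]
    rintro _ ⟨_, rfl | ⟨i, rfl⟩, rfl⟩
    · exact hz ▸ Subgroup.one_mem _
    · exact Subgroup.subset_closure ⟨i, i.2, hs i i.2⟩
  rw [htop, Subgroup.coe_top, Set.finite_univ_iff] at hfin
  exact Finite.of_subgroup_quotient K

theorem isPGroup_two_spinT {n : ℕ} {i j : Fin (n - 1)} (h : (i : ℕ) + 2 ≤ j) :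
    IsPGroup 2 ↥(Subgroup.zpowers (spinT n i) ⊔ Subgroup.zpowers (spinT n j)) := by
  have hp : ∀ k : Fin (n - 1), IsPGroup 2 (Subgroup.zpowers (spinT n k)) := by
    rintro k ⟨_, m, rfl⟩
    refine ⟨2, Subtype.ext ?_⟩
    change (spinT n k ^ m) ^ 4 = 1
    rw [← zpow_natCast, ← zpow_mul, mul_comm, zpow_mul, zpow_natCast, spinT_pow_four, one_zpow]
  refine (hp i).to_sup_of_normal_left' (hp j) ?_
  rw [Subgroup.zpowers_le]
  refine Subgroup.mem_normalizer_fintype ?_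
  rintro _ ⟨m, rfl⟩
  have hconj : spinT n j * spinT n i * (spinT n j)⁻¹ = (spinT n i ^ 2)⁻¹ * spinT n i := by
    rw [spinT_sq, ← commutator_spinT h, commutatorElement_def]
    group
  have hi := Subgroup.mem_zpowers (spinT n i)
  change spinT n j * spinT n i ^ m * (spinT n j)⁻¹ ∈ Subgroup.zpowers (spinT n i)
  rw [← conj_zpow, hconj]
  exact zpow_mem (mul_mem (inv_mem (pow_mem hi 2)) hi) m

open scoped commutatorElement in
theorem exists_mem_commutator_eq_spinZ {n : ℕ} (hn : 4 ≤ n) (D : Sylow 2 (SpinSym n)) :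
    ∃ a ∈ D, ∃ b ∈ D, ⁅a, b⁆ = spinZ n := by
  let i : Fin (n - 1) := ⟨0, by omega⟩
  let j : Fin (n - 1) := ⟨2, by omega⟩
  have hij : (i : ℕ) + 2 ≤ j := le_rfl
  obtain ⟨P, hP⟩ := (isPGroup_two_spinT hij).exists_le_sylow
  obtain ⟨g, rfl⟩ := MulAction.exists_smul_eq (SpinSym n) P D
  have hmem : ∀ x ∈ P, g * x * g⁻¹ ∈ g • P := fun x hx => ⟨x, hx, rfl⟩
  refine ⟨_, hmem _ (hP (Subgroup.mem_sup_left (Subgroup.mem_zpowers (spinT n i)))), _,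
    hmem _ (hP (Subgroup.mem_sup_right (Subgroup.mem_zpowers (spinT n j)))), ?_⟩
  rw [← conjugate_commutatorElement, commutator_spinT hij, (commute_spinZ g).eq,
    mul_inv_cancel_right]

/-- For `w ≥ 2` and `D̃` a Sylow 2-subgroup of `S̃₂ᵥᵥ`, the central element `z` lies in the
commutator subgroup of `D̃`; equivalently every homomorphism `D̃ →* ℂˣ` sends `z` to 1. -/
theorem spinZ_mem_commutator_sylow_spinSym (w : ℕ) (hw : 2 ≤ w)
    (D : Sylow 2 (SpinSym (2 * w))) :
    spinZ (2 * w) ∈ ⁅(D : Subgroup (SpinSym (2 * w))), (D : Subgroup (SpinSym (2 * w)))⁆ ∧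
    ∀ f : ↥(D : Subgroup (SpinSym (2 * w))) →* ℂˣ,
      ∀ h : spinZ (2 * w) ∈ (D : Subgroup (SpinSym (2 * w))),
        f ⟨spinZ (2 * w), h⟩ = 1 := by
  have hw' : 4 ≤ 2 * w := by omega
  obtain ⟨a, ha, b, hb, hab⟩ := exists_mem_commutator_eq_spinZ hw' D
  refine ⟨hab ▸ Subgroup.commutator_mem_commutator ha hb, fun f h => ?_⟩
  open scoped commutatorElement in
  have he : (⟨spinZ (2 * w), h⟩ : ↥(D : Subgroup (SpinSym (2 * w)))) =
      ⁅(⟨a, ha⟩ : ↥(D : Subgroup (SpinSym (2 * w)))), ⟨b, hb⟩⁆ :=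
    Subtype.ext hab.symm
  rw [he, map_commutatorElement, commutatorElement_eq_one_iff_commute]
  exact Commute.all _ _
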